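/- arXiv:math/0206214 — 4 statements merged into one kernel-verified Lean document; each statement's English description precedes it below -/
import Mathlib

section
/- Let n ≥ 1, let a = (a₁,…,aₙ) ∈ 𝔻ⁿ, let c₁,…,cₙ be positive integers, set m := ∏ⱼ cⱼ and mⱼ := m/cⱼ (an integer). For z ∈ 𝔻ⁿ define L(z) := inf{ m·log|ζ₀| : there exist a holomorphic map φ = (φ₁,…,φₙ) : 𝔻 → 𝔻ⁿ and ζ₀ ∈ 𝔻 such that φ(0) = z and, for each 1 ≤ j ≤ n, the holomorphic function φⱼ − aⱼ vanishes at ζ₀ to order at least mⱼ }. Then for every z ∈ 𝔻ⁿ, L(z) = max_{1≤j≤n} cⱼ·log|φ_{aⱼ}(zⱼ)| (with the convention log 0 = −∞). (This expresses the equality L_S = G_S of the generalized Lempert and Green functions on the polydisc for a single pole a with indicator Ψ(w) = max_j cⱼ log|wⱼ|, whose Green function is the right-hand side.) -/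
open Complex Metric Filter Topology

noncomputable section

/-- The open unit disc in `ℂ`. -/
def unitDisc : Set ℂ := Metric.ball 0 1

/-- Extended-real logarithm, with the convention `log 0 = ⊥`. -/
def elog (x : ℝ) : EReal := if x = 0 then ⊥ else ((Real.log x : ℝ) : EReal)

/-- The Möbius involution of the unit disc exchanging `ξ` and `0`. -/
def mobius (ξ ζ : ℂ) : ℂ := (ξ - ζ) / (1 - (starRingEnd ℂ) ξ * ζ)

lemma mob_den_ne {a z : ℂ} (ha : a ∈ unitDisc) (hz : z ∈ unitDisc) :
    1 - (starRingEnd ℂ) a * z ≠ 0 := by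
  simp only [unitDisc, mem_ball_zero_iff] at ha hz
  intro h
  have h1 : (starRingEnd ℂ) a * z = 1 := (sub_eq_zero.mp h).symm
  have h2 := congrArg norm h1
  rw [norm_mul, RCLike.norm_conj, norm_one] at h2
  nlinarith [norm_nonneg a, norm_nonneg z]

lemma mob_mem {a z : ℂ} (ha : a ∈ unitDisc) (hz : z ∈ unitDisc) :
    mobius a z ∈ unitDisc := by
  have hd := mob_den_ne ha hz
  simp only [unitDisc, mem_ball_zero_iff] at ha hz ⊢
  rw [mobius, norm_div, div_lt_one (norm_pos_iff.mpr hd)]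
  apply lt_of_pow_lt_pow_left₀ 2 (norm_nonneg _)
  have ha2 : ‖a‖ ^ 2 < 1 := by nlinarith [norm_nonneg a]
  have hz2 : ‖z‖ ^ 2 < 1 := by nlinarith [norm_nonneg z]
  simp only [← Complex.normSq_eq_norm_sq, Complex.normSq_apply] at *
  simp
  nlinarith [mul_pos (sub_pos.mpr ha2) (sub_pos.mpr hz2)]

lemma one_sub_conj_ne {a : ℂ} (ha : a ∈ unitDisc) : 1 - (starRingEnd ℂ) a * a ≠ 0 :=
  mob_den_ne ha ha

lemma mob_invol {a z : ℂ} (ha : a ∈ unitDisc) (hz : z ∈ unitDisc) :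
    mobius a (mobius a z) = z := by
  have hd := mob_den_ne ha hz
  have hd2 := mob_den_ne ha (mob_mem ha hz)
  rw [mobius, div_eq_iff hd2]
  have e : mobius a z * (1 - (starRingEnd ℂ) a * z) = a - z := by
    rw [mobius, div_mul_cancel₀ _ hd]
  apply mul_right_cancel₀ hd
  linear_combination (z * (starRingEnd ℂ) a - 1) * e

lemma mob_diff {a : ℂ} (ha : a ∈ unitDisc) : DifferentiableOn ℂ (mobius a) unitDisc := by
  unfold mobius
  refine DifferentiableOn.div (by fun_prop) (by fun_prop) (fun z hz => mob_den_ne ha hz)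

lemma mob_zero (a : ℂ) : mobius a 0 = a := by simp [mobius]

lemma mob_self (a : ℂ) : mobius a a = 0 := by simp [mobius]

lemma zero_mem_disc : (0 : ℂ) ∈ unitDisc := by simp [unitDisc]

lemma disc_nhds {z : ℂ} (hz : z ∈ unitDisc) : unitDisc ∈ 𝓝 z := isOpen_ball.mem_nhds hz

lemma elog_pow {x : ℝ} {k : ℕ} (hk : 0 < k) : ((k : ℝ) : EReal) * elog x = elog (x ^ k) := by
  unfold elog
  by_cases h : x = 0
  · simp only [h, if_true, ne_eq, hk.ne', not_false_eq_true, zero_pow]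
    exact EReal.coe_mul_bot_of_pos (by exact_mod_cast hk)
  · simp only [h, if_false, pow_eq_zero_iff hk.ne', Real.log_pow]
    exact (EReal.coe_mul _ _).symm

lemma elog_mono {x y : ℝ} (hx : 0 ≤ x) (h : x ≤ y) : elog x ≤ elog y := by
  unfold elog
  by_cases h0 : x = 0
  · simp [h0]
  · have hx' : 0 < x := lt_of_le_of_ne hx (Ne.symm h0)
    have hy : y ≠ 0 := (hx'.trans_le h).ne'
    simp only [h0, hy, if_false]
    exact_mod_cast Real.log_le_log hx' h

lemma schwarz_order {f : ℂ → ℂ} {a ζ₀ : ℂ} {k : ℕ} (hk : 0 < k) (ha : a ∈ unitDisc)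
    (hζ : ζ₀ ∈ unitDisc) (hf : DifferentiableOn ℂ f unitDisc)
    (hm : ∀ w ∈ unitDisc, f w ∈ unitDisc)
    (hv : ∀ i < k, iteratedDeriv i (fun w => f w - a) ζ₀ = 0) :
    ‖mobius a (f 0)‖ ≤ ‖ζ₀‖ ^ k := by
  obtain ⟨n, rfl⟩ : ∃ n, k = n + 1 := ⟨k - 1, by omega⟩
  have hfa : AnalyticAt ℂ (fun w => f w - a) ζ₀ :=
    (hf.analyticAt (disc_nhds hζ)).sub analyticAt_const
  obtain ⟨g, hg, hfg⟩ := (natCast_le_analyticOrderAt hfa).mp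
    ((natCast_le_analyticOrderAt_iff_iteratedDeriv_eq_zero hfa).mpr hv)
  have hfζ : f ζ₀ = a := by
    have := hfg.self_of_nhds
    simpa [sub_eq_zero] using this
  have hO1 : (fun w => f w - a) =O[𝓝 ζ₀] (fun w => (w - ζ₀) ^ (n + 1)) := by
    refine (Asymptotics.IsBigO.congr' (f₁ := fun w => (w - ζ₀) ^ (n + 1) * g w)
      (g₁ := fun w => (w - ζ₀) ^ (n + 1) * (1 : ℂ)) ?_ ?_ ?_)
    · exact (Asymptotics.isBigO_refl _ _).mul (hg.continuousAt.isBigO_one ℂ)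
    · filter_upwards [hfg] with w hw
      rw [hw, smul_eq_mul]
    · filter_upwards with w
      simp
  have hO2 : (fun w => mobius a (f w)) =O[𝓝 ζ₀] (fun w => f w - a) := by
    have h1 := ((mob_diff ha).differentiableAt (disc_nhds ha)).isBigO_sub
    have h2 : Tendsto f (𝓝 ζ₀) (𝓝 a) := by
      have := (hf.differentiableAt (disc_nhds hζ)).continuousAt.tendsto
      rwa [hfζ] at this
    have h3 := h1.comp_tendsto h2
    simpa [Function.comp_def, mob_self] using h3
  have hmt : Tendsto (mobius ζ₀) (𝓝 0) (𝓝 ζ₀) := by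
    have := ((mob_diff hζ).differentiableAt (disc_nhds zero_mem_disc)).continuousAt.tendsto
    rwa [mob_zero] at this
  have hO3 : (fun w => mobius ζ₀ w - ζ₀) =O[𝓝 0] (fun w => w) := by
    have h1 := ((mob_diff hζ).differentiableAt (disc_nhds zero_mem_disc)).isBigO_sub
    simpa [mob_zero] using h1
  have hO : (fun w => mobius a (f (mobius ζ₀ w))) =O[𝓝 0] (fun w => w ^ (n + 1)) :=
    ((hO2.trans hO1).comp_tendsto hmt).trans (hO3.pow (n + 1))
  have hF : DifferentiableOn ℂ (fun w => mobius a (f (mobius ζ₀ w))) unitDisc :=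
    (mob_diff ha).comp (hf.comp (mob_diff hζ) (fun w hw => mob_mem hζ hw))
      (fun w hw => hm _ (mob_mem hζ hw))
  have hF0 : mobius a (f (mobius ζ₀ 0)) = 0 := by rw [mob_zero, hfζ, mob_self]
  have key := Complex.dist_le_mul_div_pow_of_mapsTo_ball_of_isLittleO
    (f := fun w => mobius a (f (mobius ζ₀ w))) (c := 0) (z := ζ₀) (R₁ := 1) (R₂ := 1) (n := n)
    hF (by
      intro w hw
      show _ ∈ closedBall (mobius a (f (mobius ζ₀ 0))) 1
      rw [hF0]
      exact ball_subset_closedBall (mob_mem ha (hm _ (mob_mem hζ hw)))) (by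
      simp only [hF0, sub_zero]
      refine hO.trans_isLittleO ?_
      have : (fun w : ℂ => w ^ (n + 1)) =o[𝓝 0] (fun w : ℂ => w ^ n) :=
        Asymptotics.isLittleO_pow_pow (Nat.lt_succ_self n)
      simpa using this.norm_right) hζ
  simpa [hF0, mob_self] using key

lemma construct {a b ζ₀ : ℂ} {k : ℕ} (hk : 0 < k) (ha : a ∈ unitDisc)
    (hb : b ∈ unitDisc)
    (hζ : ζ₀ ∈ unitDisc) (hle : ‖mobius a b‖ ≤ ‖ζ₀‖ ^ k) :
    ∃ f : ℂ → ℂ, DifferentiableOn ℂ f unitDisc ∧ (∀ w ∈ unitDisc, f w ∈ unitDisc) ∧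
      f 0 = b ∧ ∀ i < k, iteratedDeriv i (fun w => f w - a) ζ₀ = 0 := by
  set C : ℂ := mobius a b / ζ₀ ^ k with hC
  have hC1 : ‖C‖ ≤ 1 := by
    rw [hC, norm_div, norm_pow]
    exact div_le_one_of_le₀ hle (by positivity)
  have hCb : C * ζ₀ ^ k = mobius a b := by
    refine div_mul_cancel_of_imp fun h => ?_
    rw [← norm_pow, h, norm_zero] at hle
    exact norm_le_zero_iff.mp hle
  set ψ : ℂ → ℂ := fun w => C * mobius ζ₀ w ^ k with hψ
  have hψd : DifferentiableOn ℂ ψ unitDisc := ((mob_diff hζ).pow k).const_mul C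
  have hψm : ∀ w ∈ unitDisc, ψ w ∈ unitDisc := by
    intro w hw
    have h := mob_mem hζ hw
    simp only [unitDisc, mem_ball_zero_iff] at h ⊢
    rw [hψ]
    simp only [norm_mul, norm_pow]
    have := pow_lt_one₀ (norm_nonneg _) h hk.ne'
    nlinarith [norm_nonneg C, pow_nonneg (norm_nonneg (mobius ζ₀ w)) k]
  have hfd : DifferentiableOn ℂ (fun w => mobius a (ψ w)) unitDisc := (mob_diff ha).comp hψd hψm
  refine ⟨fun w => mobius a (ψ w), hfd, fun w hw => mob_mem ha (hψm w hw), ?_, ?_⟩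
  · simp only [hψ, mob_zero, hCb]
    exact mob_invol ha hb
  · have hfa : AnalyticAt ℂ (fun w => mobius a (ψ w) - a) ζ₀ :=
      (hfd.analyticAt (disc_nhds hζ)).sub analyticAt_const
    rw [← natCast_le_analyticOrderAt_iff_iteratedDeriv_eq_zero hfa, natCast_le_analyticOrderAt hfa]
    refine ⟨fun w => C * (-1 / (1 - (starRingEnd ℂ) ζ₀ * w)) ^ k *
      (-(1 - (starRingEnd ℂ) a * a) / (1 - (starRingEnd ℂ) a * ψ w)), ?_, ?_⟩
    · have hψa : AnalyticAt ℂ ψ ζ₀ := hψd.analyticAt (disc_nhds hζ)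
      have h1 := mob_den_ne hζ hζ
      have h2 := mob_den_ne ha (hψm _ hζ)
      have e1 : AnalyticAt ℂ (fun w => -1 / (1 - (starRingEnd ℂ) ζ₀ * w)) ζ₀ :=
        AnalyticAt.div (by fun_prop) (by fun_prop) h1
      have e2 : AnalyticAt ℂ (fun w => -(1 - (starRingEnd ℂ) a * a) /
          (1 - (starRingEnd ℂ) a * ψ w)) ζ₀ :=
        AnalyticAt.div (by fun_prop) (by fun_prop) h2
      exact (analyticAt_const.mul (e1.pow k)).mul e2
    · filter_upwards [disc_nhds hζ] with w hw
      have h2 := mob_den_ne ha (hψm _ hw)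
      have e1 : mobius a (ψ w) - a = ψ w * (-(1 - (starRingEnd ℂ) a * a) /
          (1 - (starRingEnd ℂ) a * ψ w)) := by
        rw [mobius, sub_eq_iff_eq_add, div_eq_iff h2, add_mul, mul_assoc, div_mul_cancel₀ _ h2]
        ring
      have e2 : mobius ζ₀ w = (w - ζ₀) * (-1 / (1 - (starRingEnd ℂ) ζ₀ * w)) := by
        rw [mobius]; ring
      have e3 : ψ w = (w - ζ₀) ^ k * (C * (-1 / (1 - (starRingEnd ℂ) ζ₀ * w)) ^ k) := by
        simp only [hψ]
        rw [e2, mul_pow]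
        ring
      rw [e1, smul_eq_mul]
      generalize -(1 - (starRingEnd ℂ) a * a) / (1 - (starRingEnd ℂ) a * ψ w) = q
      rw [e3]
      ring

/-- The generalized Lempert function `L_S` equals the generalized Green function `G_S`
on the polydisc for one pole `a` with indicator `Ψ(w) = max_j c_j log|w_j|`. -/
theorem lempert_eq_green_polydisc_one_pole
    (n : ℕ) (hn : 1 ≤ n) (a : Fin n → ℂ) (ha : ∀ j, a j ∈ unitDisc)
    (c : Fin n → ℕ) (hc : ∀ j, 0 < c j) (m : ℕ) (hm : m = ∏ j, c j)
    (z : Fin n → ℂ) (hz : ∀ j, z j ∈ unitDisc) :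
    sInf { t : EReal | ∃ (φ : ℂ → Fin n → ℂ) (ζ₀ : ℂ), ζ₀ ∈ unitDisc ∧
        (∀ j, DifferentiableOn ℂ (fun w => φ w j) unitDisc) ∧
        (∀ w ∈ unitDisc, ∀ j, φ w j ∈ unitDisc) ∧
        φ 0 = z ∧
        (∀ j, ∀ k < m / c j, iteratedDeriv k (fun w => φ w j - a j) ζ₀ = 0) ∧
        t = ((m : ℝ) : EReal) * elog ‖ζ₀‖ }
      = ⨆ j, ((c j : ℝ) : EReal) * elog ‖mobius (a j) (z j)‖ := by
  have hcm : ∀ j, c j ∣ m := fun j => hm ▸ Finset.dvd_prod_of_mem c (Finset.mem_univ j)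
  have hmpos : 0 < m := hm ▸ Finset.prod_pos (fun j _ => hc j)
  have hk : ∀ j, 0 < m / c j := fun j => Nat.div_pos (Nat.le_of_dvd hmpos (hcm j)) (hc j)
  have hmul : ∀ j, m / c j * c j = m := fun j => Nat.div_mul_cancel (hcm j)
  simp only [elog_pow hmpos, elog_pow (hc _)]
  apply le_antisymm
  · have : Nonempty (Fin n) := ⟨⟨0, hn⟩⟩
    obtain ⟨j₀, hj₀⟩ := Finite.exists_max (fun j => ‖mobius (a j) (z j)‖ ^ c j)
    set r : ℝ := ‖mobius (a j₀) (z j₀)‖ ^ c j₀ with hr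
    have hr0 : 0 ≤ r := by positivity
    have hr1 : r < 1 := by
      have h := mob_mem (ha j₀) (hz j₀)
      simp only [unitDisc, mem_ball_zero_iff] at h
      exact pow_lt_one₀ (norm_nonneg _) h (hc j₀).ne'
    set s : ℝ := r ^ ((m : ℝ)⁻¹) with hs
    have hs0 : 0 ≤ s := Real.rpow_nonneg hr0 _
    have hsm : s ^ m = r := Real.rpow_inv_natCast_pow hr0 hmpos.ne'
    have hs1 : s < 1 := by
      by_contra h
      have := one_le_pow₀ (n := m) (not_lt.mp h)
      linarith
    have hns : ‖(s : ℂ)‖ = s := by simp [abs_of_nonneg hs0]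
    have hsd : (s : ℂ) ∈ unitDisc := by
      simpa only [unitDisc, mem_ball_zero_iff, hns] using hs1
    have hle : ∀ j, ‖mobius (a j) (z j)‖ ≤ ‖(s : ℂ)‖ ^ (m / c j) := by
      intro j
      rw [hns]
      apply le_of_pow_le_pow_left₀ (hc j).ne' (by positivity)
      rw [← pow_mul, hmul, hsm]
      exact hj₀ j
    choose f hf1 hf2 hf3 hf4 using fun j => construct (hk j) (ha j) (hz j) hsd (hle j)
    refine le_trans (sInf_le ⟨fun w j => f j w, (s : ℂ), hsd, hf1, fun w hw j => hf2 j w hw,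
      funext hf3, hf4, rfl⟩) ?_
    rw [hns, hsm]
    exact le_iSup (fun j => elog (‖mobius (a j) (z j)‖ ^ c j)) j₀
  · refine le_sInf ?_
    rintro t ⟨φ, ζ₀, hζ, hd, hmap, h0, hv, rfl⟩
    refine iSup_le fun j => elog_mono (by positivity) ?_
    have h := schwarz_order (hk j) (ha j) hζ (hd j) (fun w hw => hmap w hw j) (hv j)
    simp only [h0] at h
    calc _ ≤ (‖ζ₀‖ ^ (m / c j)) ^ c j := pow_le_pow_left₀ (norm_nonneg _) h _
      _ = _ := by rw [← pow_mul, hmul]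
end
end

section
/- Let g : (−∞,0)ⁿ → (−∞,0] be convex, nondecreasing in each variable, and positively homogeneous of degree 1 (g(λx) = λg(x) for all λ > 0), and define Ψ(w) := g(log|w₁|,…,log|wₙ|) for w ∈ 𝔻ⁿ with all components nonzero. Let τ > 0, C ∈ ℝ, and let φ : 𝔻 → 𝔻ⁿ be holomorphic with no component identically zero, satisfying Ψ(φ(ζ)) ≤ τ·log|ζ| + C for all ζ ∈ 𝔻 \ {0} at which all components of φ(ζ) are nonzero. Then there exists m ∈ ℕ such that: for every holomorphic h : 𝔻 → ℂⁿ with φ + h mapping 𝔻 into 𝔻ⁿ and with hⱼ⁽ᵏ⁾(0) = 0 for all 1 ≤ j ≤ n and 0 ≤ k ≤ m, there exist C′ ∈ ℝ and ρ > 0 such that Ψ(φ(ζ) + h(ζ)) ≤ τ·log|ζ| + C′ for all ζ with 0 < |ζ| < ρ at which all components of φ(ζ) + h(ζ) are nonzero. -/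
open Complex Metric Filter Topology

noncomputable section

theorem ip_component (f : ℂ → ℂ) (hf : DifferentiableOn ℂ f unitDisc)
    (hmaps : ∀ w ∈ unitDisc, f w ∈ unitDisc) (hnz : ∃ w ∈ unitDisc, f w ≠ 0) :
    ∃ p : ℕ, ∀ m : ℕ, p ≤ m → ∀ h : ℂ → ℂ, DifferentiableOn ℂ h unitDisc →
      (∀ k ≤ m, iteratedDeriv k h 0 = 0) →
      ∃ D : ℝ, 0 ≤ D ∧ ∀ᶠ ζ in 𝓝[≠] (0 : ℂ), f ζ ≠ 0 ∧ Real.log ‖f ζ‖ < 0 ∧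
        (f ζ + h ζ ≠ 0 → Real.log ‖f ζ + h ζ‖ ≤ (1 - D * ‖ζ‖) * Real.log ‖f ζ‖) := by
  have hopen : IsOpen unitDisc := Metric.isOpen_ball
  have h0 : (0 : ℂ) ∈ unitDisc := by simp [unitDisc]
  have hfan : AnalyticAt ℂ f 0 := hf.analyticAt (hopen.mem_nhds h0)
  have hne : ¬ ∀ᶠ z in 𝓝 (0 : ℂ), f z = 0 := by
    intro hev
    obtain ⟨w, hw, hw'⟩ := hnz
    exact hw' ((hf.analyticOnNhd hopen).eqOn_zero_of_preconnected_of_eventuallyEq_zero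
      (convex_ball (0 : ℂ) 1).isPreconnected h0 hev hw)
  obtain ⟨p, u, hu, hu0, hfu⟩ := hfan.exists_eventuallyEq_pow_smul_nonzero_iff.mpr hne
  refine ⟨p, fun m hpm h hh hder => ?_⟩
  have hhan : AnalyticAt ℂ h 0 := hh.analyticAt (hopen.mem_nhds h0)
  have hord : ((m + 1 : ℕ) : ℕ∞) ≤ analyticOrderAt h 0 :=
    (natCast_le_analyticOrderAt_iff_iteratedDeriv_eq_zero hhan).mpr
      (fun k hk => hder k (by omega))
  obtain ⟨v, hv, hhv⟩ := (natCast_le_analyticOrderAt hhan).mp hord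
  have hc : 0 < ‖u 0‖ / 2 := by positivity
  set c := ‖u 0‖ / 2 with hcdef
  have hcu : ∀ᶠ z in 𝓝 (0 : ℂ), c < ‖u z‖ :=
    hu.continuousAt.norm.eventually (lt_mem_nhds (by rw [hcdef]; linarith))
  set B := ‖v 0‖ + 1 with hB
  have hBv : ∀ᶠ z in 𝓝 (0 : ℂ), ‖v z‖ < B :=
    hv.continuousAt.norm.eventually (gt_mem_nhds (by rw [hB]; linarith))
  have hB0 : 0 < B := by positivity
  have hf0 : ‖f 0‖ < 1 := by simpa [unitDisc] using hmaps 0 h0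
  obtain ⟨a, ha, hfa⟩ : ∃ a : ℝ, 0 < a ∧ ‖f 0‖ < Real.exp (-a) := by
    have ht : Tendsto (fun a : ℝ => Real.exp (-a)) (𝓝[>] 0) (𝓝 1) := by
      have : ContinuousAt (fun a : ℝ => Real.exp (-a)) 0 := by fun_prop
      simpa [ContinuousAt] using this.tendsto.mono_left (nhdsWithin_le_nhds (s := Set.Ioi 0))
    obtain ⟨a, h1, h2⟩ := ((ht.eventually (lt_mem_nhds hf0)).and self_mem_nhdsWithin).exists
    exact ⟨a, h2, h1⟩
  have hfe : ∀ᶠ z in 𝓝 (0 : ℂ), ‖f z‖ < Real.exp (-a) :=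
    hfan.continuousAt.norm.eventually (gt_mem_nhds hfa)
  have hball : ∀ᶠ z in 𝓝 (0 : ℂ), z ∈ unitDisc := hopen.mem_nhds h0
  refine ⟨B / c / a, by positivity, ?_⟩
  filter_upwards [nhdsWithin_le_nhds hfu, nhdsWithin_le_nhds hhv, nhdsWithin_le_nhds hcu,
    nhdsWithin_le_nhds hBv, nhdsWithin_le_nhds hfe, nhdsWithin_le_nhds hball,
    self_mem_nhdsWithin] with z e1 e2 e3 e4 e5 e6 e7
  have hz : z ≠ 0 := e7
  have hzn : 0 < ‖z‖ := norm_pos_iff.mpr hz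
  have hz1 : ‖z‖ < 1 := by simpa [unitDisc] using e6
  simp only [sub_zero, smul_eq_mul] at e1 e2
  have hfz : f z ≠ 0 := by
    rw [e1]
    exact mul_ne_zero (pow_ne_zero _ hz) (norm_pos_iff.mp (hc.trans e3))
  have hfn : 0 < ‖f z‖ := norm_pos_iff.mpr hfz
  have hlog : Real.log ‖f z‖ < -a := (Real.log_lt_iff_lt_exp hfn).mpr e5
  refine ⟨hfz, by linarith, fun hsum => ?_⟩
  have hhf : ‖h z‖ ≤ B / c * ‖z‖ * ‖f z‖ := by
    rw [e1, e2, norm_mul, norm_mul, norm_pow, norm_pow]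
    have h1 : ‖z‖ ^ (m + 1) ≤ ‖z‖ * ‖z‖ ^ p := by
      rw [← pow_succ']
      exact pow_le_pow_of_le_one hzn.le hz1.le (by omega)
    have h2 : B ≤ B / c * ‖u z‖ := by
      rw [div_mul_eq_mul_div, le_div_iff₀ hc]
      exact mul_le_mul_of_nonneg_left e3.le hB0.le
    calc ‖z‖ ^ (m + 1) * ‖v z‖ ≤ (‖z‖ * ‖z‖ ^ p) * (B / c * ‖u z‖) := by
          gcongr
          exact e4.le.trans h2
      _ = _ := by ring
  have hle : ‖f z + h z‖ ≤ (1 + B / c * ‖z‖) * ‖f z‖ := by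
    have := norm_add_le (f z) (h z)
    linarith
  have hK : 0 < 1 + B / c * ‖z‖ := by positivity
  have hl := Real.log_le_log (norm_pos_iff.mpr hsum) hle
  rw [Real.log_mul hK.ne' hfn.ne'] at hl
  have hl2 := Real.log_le_sub_one_of_pos hK
  have h3 : B / c * ‖z‖ ≤ B / c / a * ‖z‖ * (-Real.log ‖f z‖) := by
    calc B / c * ‖z‖ = B / c / a * ‖z‖ * a := by field_simp
      _ ≤ _ := by
        gcongr
        linarith
  linarith

/-- Local perturbation lemma for indicators (Lemma `locperturb`):
if `Ψ(φ(ζ)) ≤ τ log|ζ| + C` near `0`, then the same holds (with another constant)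
after a perturbation `h` vanishing at `0` to sufficiently high order. -/
theorem indicator_perturbation
    (n : ℕ) (g : (Fin n → ℝ) → ℝ)
    (hconv : ConvexOn ℝ {x : Fin n → ℝ | ∀ j, x j < 0} g)
    (hmono : ∀ x ∈ {x : Fin n → ℝ | ∀ j, x j < 0},
      ∀ y ∈ {x : Fin n → ℝ | ∀ j, x j < 0}, (∀ j, x j ≤ y j) → g x ≤ g y)
    (hhom : ∀ lam : ℝ, 0 < lam →
      ∀ x ∈ {x : Fin n → ℝ | ∀ j, x j < 0}, g (lam • x) = lam * g x)
    (hneg : ∀ x ∈ {x : Fin n → ℝ | ∀ j, x j < 0}, g x ≤ 0)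
    (τ C : ℝ) (hτ : 0 < τ)
    (φ : ℂ → Fin n → ℂ)
    (hφdiff : ∀ j, DifferentiableOn ℂ (fun w => φ w j) unitDisc)
    (hφmaps : ∀ w ∈ unitDisc, ∀ j, φ w j ∈ unitDisc)
    (hφnz : ∀ j, ∃ w ∈ unitDisc, φ w j ≠ 0)
    (hΨ : ∀ ζ ∈ unitDisc, ζ ≠ 0 → (∀ j, φ ζ j ≠ 0) →
      g (fun j => Real.log ‖φ ζ j‖) ≤ τ * Real.log ‖ζ‖ + C) :
    ∃ m : ℕ, ∀ h : ℂ → Fin n → ℂ,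
      (∀ j, DifferentiableOn ℂ (fun w => h w j) unitDisc) →
      (∀ w ∈ unitDisc, ∀ j, φ w j + h w j ∈ unitDisc) →
      (∀ j, ∀ k ≤ m, iteratedDeriv k (fun w => h w j) 0 = 0) →
      ∃ (C' ρ : ℝ), 0 < ρ ∧ ∀ ζ ∈ unitDisc, ζ ≠ 0 → ‖ζ‖ < ρ →
        (∀ j, φ ζ j + h ζ j ≠ 0) →
        g (fun j => Real.log ‖φ ζ j + h ζ j‖)
          ≤ τ * Real.log ‖ζ‖ + C' := by
  choose p hp using fun j => ip_component (fun w => φ w j) (hφdiff j)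
    (fun w hw => hφmaps w hw j) (hφnz j)
  refine ⟨∑ j, p j, fun h hh hmap hder => ?_⟩
  choose D hD hev using fun j => hp j (∑ j, p j)
    (Finset.single_le_sum (fun i _ => Nat.zero_le (p i)) (Finset.mem_univ j))
    (fun w => h w j) (hh j) (hder j)
  set E : ℝ := ∑ j, D j with hE
  have hE0 : 0 ≤ E := Finset.sum_nonneg fun j _ => hD j
  have hDE : ∀ j, D j ≤ E := fun j =>
    Finset.single_le_sum (fun i _ => hD i) (Finset.mem_univ j)
  have hsmall : ∀ᶠ ζ in 𝓝[≠] (0 : ℂ), E * ‖ζ‖ < 1 := by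
    apply nhdsWithin_le_nhds
    have : ContinuousAt (fun ζ : ℂ => E * ‖ζ‖) 0 := by fun_prop
    exact this.eventually (gt_mem_nhds (by simp))
  have hall := (Filter.eventually_all.mpr hev).and hsmall
  rw [eventually_nhdsWithin_iff, Metric.eventually_nhds_iff] at hall
  obtain ⟨ρ, hρ, hall⟩ := hall
  refine ⟨C + E * τ + E * |C|, ρ, hρ, fun ζ hζ hζ0 hζρ hnz => ?_⟩
  obtain ⟨hcomp, hs⟩ := hall (by simpa using hζρ) hζ0
  have hr : 0 < ‖ζ‖ := norm_pos_iff.mpr hζ0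
  have hr1 : ‖ζ‖ < 1 := by simpa [unitDisc] using hζ
  have hx : (fun j => Real.log ‖φ ζ j‖) ∈ {x : Fin n → ℝ | ∀ j, x j < 0} :=
    fun j => (hcomp j).2.1
  have ht : 0 < 1 - E * ‖ζ‖ := by linarith
  have hy : (1 - E * ‖ζ‖) • (fun j => Real.log ‖φ ζ j‖) ∈
      {x : Fin n → ℝ | ∀ j, x j < 0} := fun j => mul_neg_of_pos_of_neg ht (hx j)
  have hw : (fun j => Real.log ‖φ ζ j + h ζ j‖) ∈ {x : Fin n → ℝ | ∀ j, x j < 0} := by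
    intro j
    have : ‖φ ζ j + h ζ j‖ < 1 := by simpa [unitDisc] using hmap ζ hζ j
    exact Real.log_neg (norm_pos_iff.mpr (hnz j)) this
  have h1 := hmono _ hw _ hy (fun j => by
    refine ((hcomp j).2.2 (hnz j)).trans ?_
    show _ ≤ (1 - E * ‖ζ‖) * Real.log ‖φ ζ j‖
    refine mul_le_mul_of_nonpos_right ?_ (hx j).le
    have := mul_le_mul_of_nonneg_right (hDE j) hr.le
    linarith)
  rw [hhom _ ht _ hx] at h1
  have h2 := mul_le_mul_of_nonneg_left (hΨ ζ hζ hζ0 fun j => (hcomp j).1) ht.le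
  have h3 : ‖ζ‖ * (-Real.log ‖ζ‖) ≤ 1 := by
    have := Real.log_le_sub_one_of_pos (inv_pos.mpr hr)
    rw [Real.log_inv] at this
    have h4 := mul_le_mul_of_nonneg_left this hr.le
    rw [mul_sub, mul_inv_cancel₀ hr.ne'] at h4
    linarith
  have h4 : E * τ * (‖ζ‖ * (-Real.log ‖ζ‖)) ≤ E * τ * 1 :=
    mul_le_mul_of_nonneg_left h3 (by positivity)
  have h5 : ‖ζ‖ * (-C) ≤ |C| := by
    calc ‖ζ‖ * (-C) ≤ ‖ζ‖ * |C| := by gcongr; exact neg_le_abs C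
      _ ≤ 1 * |C| := by gcongr
      _ = |C| := one_mul _
  have h6 := mul_le_mul_of_nonneg_left h5 hE0
  linarith
end
end

section
/- Let B₀ be a finite Blaschke product, i.e. B₀(ζ) = e^{iθ₀} ∏_{l=1}^{d} (α_l − ζ)/(1 − ᾱ_l ζ) with θ₀ ∈ ℝ, d ≥ 0 and α₁,…,α_d ∈ 𝔻. Let γ ∈ 𝔻 and let m be a positive integer. Then there exist ζ* ∈ 𝔻 and a holomorphic function f : 𝔻 → 𝔻 such that f = B₀·g̃ for some holomorphic g̃ : 𝔻 → 𝔻 (closure allowed: |g̃| ≤ 1), f(ζ*) = γ, and f⁽ᵏ⁾(ζ*) = 0 for all 1 ≤ k ≤ m−1; equivalently f(ζ* + h) = γ + O(h^m) as h → 0. -/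
open Complex Metric Filter Topology

noncomputable section

lemma aux_ne {a z : ℂ} (ha : ‖a‖ < 1) (hz : ‖z‖ ≤ 1) : 1 - (starRingEnd ℂ) a * z ≠ 0 := by
  intro h
  have h1 : (starRingEnd ℂ) a * z = 1 := (sub_eq_zero.mp h).symm
  have h2 : ‖(starRingEnd ℂ) a * z‖ = 1 := by rw [h1]; simp
  rw [norm_mul, RCLike.norm_conj] at h2
  nlinarith [norm_nonneg a, norm_nonneg z]

lemma mobius_norm_lt {a z : ℂ} (ha : ‖a‖ < 1) (hz : ‖z‖ < 1) : ‖mobius a z‖ < 1 := by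
  have hne := aux_ne ha hz.le
  unfold mobius
  rw [norm_div, div_lt_one (norm_pos_iff.mpr hne)]
  have key : ‖1 - (starRingEnd ℂ) a * z‖ ^ 2 - ‖a - z‖ ^ 2 = (1 - ‖a‖ ^ 2) * (1 - ‖z‖ ^ 2) := by
    simp only [← Complex.normSq_eq_norm_sq, Complex.normSq_apply]
    simp
    ring
  have : 0 < (1 - ‖a‖ ^ 2) * (1 - ‖z‖ ^ 2) := by
    apply mul_pos <;> nlinarith [norm_nonneg a, norm_nonneg z]
  exact lt_of_pow_lt_pow_left₀ 2 (norm_nonneg _) (by linarith)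

lemma mobius_diff {a : ℂ} (ha : ‖a‖ < 1) : DifferentiableOn ℂ (mobius a) unitDisc := by
  intro z hz
  have hz' : ‖z‖ < 1 := by simpa [unitDisc] using hz
  have hne := aux_ne ha hz'.le
  unfold mobius
  apply DifferentiableAt.differentiableWithinAt
  fun_prop (disch := assumption)

lemma mobius_comp (t : ℝ) (ht : |t| < 1) {a z : ℂ} (ha : ‖a‖ < 1) (hz : ‖z‖ < 1) :
    mobius (mobius t a) (mobius t z) =
      -((1 - t * (starRingEnd ℂ) a) / (1 - t * a)) * mobius a z := by
  have htn : ‖(t : ℂ)‖ < 1 := by simpa using ht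
  have h1 : 1 - (t : ℂ) * a ≠ 0 := by simpa using aux_ne htn ha.le
  have h2 : 1 - (t : ℂ) * z ≠ 0 := by simpa using aux_ne htn hz.le
  have h3 : 1 - (t : ℂ) * (starRingEnd ℂ) a ≠ 0 := by
    have : ‖(starRingEnd ℂ) a‖ ≤ 1 := by rw [RCLike.norm_conj]; exact ha.le
    simpa using aux_ne htn this
  have h4 := aux_ne ha hz.le
  have h5 : (1 - (t : ℂ) ^ 2) ≠ 0 := by
    have : (1 - t ^ 2 : ℝ) ≠ 0 := by
      have := (sq_lt_one_iff_abs_lt_one t).mpr ht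
      linarith
    exact_mod_cast this
  have e1 : mobius t a - mobius t z
      = (1 - (t : ℂ) ^ 2) * (z - a) / ((1 - t * a) * (1 - t * z)) := by
    simp only [mobius, Complex.conj_ofReal]
    field_simp
    ring
  have e2 : 1 - (starRingEnd ℂ) (mobius t a) * mobius t z
      = (1 - (t : ℂ) ^ 2) * (1 - (starRingEnd ℂ) a * z)
        / ((1 - t * (starRingEnd ℂ) a) * (1 - t * z)) := by
    simp only [mobius, map_div₀, map_sub, map_mul, map_one, Complex.conj_ofReal]
    field_simp
    ring
  conv_lhs => rw [mobius]
  rw [e1, e2, mobius]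
  field_simp
  ring

/-- Bound function for the approximate inverse. -/
def bnd (p : ℕ) (x : ℝ) : ℝ := x⁻¹ * (1 + (1 - x ^ 2) * ∑ n ∈ Finset.range p, x⁻¹ ^ (n + 1))

lemma bnd_tendsto (p : ℕ) : Tendsto (bnd p) (𝓝 1) (𝓝 1) := by
  have h : ContinuousAt (bnd p) 1 := by
    unfold bnd
    have : ContinuousAt (fun x : ℝ => x⁻¹) 1 := continuousAt_inv₀ one_ne_zero
    fun_prop (disch := norm_num)
  have h1 : bnd p 1 = 1 := by simp [bnd]
  have h2 := h.tendsto
  rwa [h1] at h2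

/-- Approximate inverse of the Möbius factor. -/
def pinv (p : ℕ) (b w : ℂ) : ℂ :=
  b⁻¹ * (1 + ((1 - ‖b‖ ^ 2 : ℝ) : ℂ) * ∑ n ∈ Finset.range p, (b⁻¹ * w) ^ (n + 1))

lemma pinv_bound (p : ℕ) {b w : ℂ} (hb : ‖b‖ < 1) (hw : ‖w‖ < 1) :
    ‖pinv p b w‖ ≤ bnd p ‖b‖ := by
  unfold pinv bnd
  have h0 : 0 ≤ 1 - ‖b‖ ^ 2 := by nlinarith [norm_nonneg b]
  rw [norm_mul, norm_inv]
  gcongr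
  refine (norm_add_le _ _).trans ?_
  rw [norm_mul, norm_one, Complex.norm_real, Real.norm_of_nonneg h0]
  gcongr
  refine (norm_sum_le _ _).trans ?_
  gcongr with n hn
  rw [norm_pow, norm_mul, norm_inv]
  gcongr
  exact mul_le_of_le_one_right (by positivity) hw.le

lemma pinv_mul (p : ℕ) {b w : ℂ} (hb0 : b ≠ 0) (hb : ‖b‖ < 1) (hw : ‖w‖ < 1) :
    mobius b w * pinv p b w = 1 + w ^ (p + 1) *
      (-((1 - ‖b‖ ^ 2 : ℝ) : ℂ) * b⁻¹ ^ (p + 1) / (1 - (starRingEnd ℂ) b * w)) := by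
  have hne := aux_ne hb hw.le
  have hs : ((1 - ‖b‖ ^ 2 : ℝ) : ℂ) = 1 - (starRingEnd ℂ) b * b := by
    push_cast
    rw [Complex.conj_mul']
  have hg : (1 - b⁻¹ * w) * ∑ n ∈ Finset.range p, (b⁻¹ * w) ^ (n + 1)
      = b⁻¹ * w - (b⁻¹ * w) ^ (p + 1) := by
    induction p with
    | zero => simp
    | succ p ih => rw [Finset.sum_range_succ, mul_add, ih]; ring
  have e : (b - w) * pinv p b w = (1 - b⁻¹ * w) + ((1 - ‖b‖ ^ 2 : ℝ) : ℂ) *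
      (b⁻¹ * w - (b⁻¹ * w) ^ (p + 1)) := by
    rw [← hg, pinv]
    have : b - w = b * (1 - b⁻¹ * w) := by field_simp
    rw [this]
    field_simp
  have e3 : (b - w) * pinv p b w = (1 - (starRingEnd ℂ) b * w) -
      ((1 - ‖b‖ ^ 2 : ℝ) : ℂ) * (b⁻¹ * w) ^ (p + 1) := by
    rw [e, hs]
    have : b⁻¹ * b = 1 := inv_mul_cancel₀ hb0
    linear_combination (-(starRingEnd ℂ) b * w) * this
  rw [mobius, div_mul_eq_mul_div, e3, mul_pow]
  field_simp
  ring

lemma factor (p : ℕ) {a : ℂ} (ha : ‖a‖ < 1) {ε : ℝ} (hε : 0 < ε) :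
    ∀ᶠ t : ℝ in 𝓝[<] 1, ∃ R h : ℂ → ℂ, DifferentiableOn ℂ R unitDisc ∧
      DifferentiableOn ℂ h unitDisc ∧ (∀ z ∈ unitDisc, ‖R z‖ ≤ 1 + ε) ∧
      ∀ z ∈ unitDisc, mobius a z * R z = 1 + mobius t z ^ (p + 1) * h z := by
  have ha1 : (1 : ℂ) - a ≠ 0 := by
    intro h'
    have : a = 1 := (sub_eq_zero.mp h').symm
    rw [this] at ha; simp at ha
  have hlim : Tendsto (fun t : ℝ => ‖mobius t a‖) (𝓝[<] 1) (𝓝 1) := by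
    have hc : ContinuousAt (fun t : ℝ => ‖mobius t a‖) 1 := by
      simp only [mobius, Complex.conj_ofReal]
      have : (1 : ℂ) - ((1 : ℝ) : ℂ) * a ≠ 0 := by simpa using ha1
      fun_prop (disch := assumption)
    have h2 := hc.tendsto
    have h1 : ‖mobius ((1 : ℝ) : ℂ) a‖ = 1 := by simp [mobius, ha1]
    rw [h1] at h2
    exact h2.mono_left nhdsWithin_le_nhds
  have hb := ((bnd_tendsto p).comp hlim).eventually (gt_mem_nhds (show (1 : ℝ) < 1 + ε by linarith))
  have hpos := hlim.eventually (lt_mem_nhds (show (0 : ℝ) < 1 by norm_num))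
  have hlt : ∀ᶠ t : ℝ in 𝓝[<] 1, t < 1 := eventually_mem_nhdsWithin
  have hgt : ∀ᶠ t : ℝ in 𝓝[<] 1, 0 < t :=
    nhdsWithin_le_nhds (lt_mem_nhds (show (0 : ℝ) < 1 by norm_num))
  filter_upwards [hb, hpos, hlt, hgt] with t hb hpos hlt hgt
  have ht : |t| < 1 := by rw [abs_of_pos hgt]; exact hlt
  have htn : ‖(t : ℂ)‖ < 1 := by simpa using ht
  set b := mobius t a with hbdef
  have hb1 : ‖b‖ < 1 := mobius_norm_lt htn ha
  have hb0 : b ≠ 0 := norm_pos_iff.mp hpos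
  have hmd := mobius_diff htn
  have hk : 1 - (t : ℂ) * a ≠ 0 := by simpa using aux_ne htn ha.le
  refine ⟨fun z => -((1 - t * (starRingEnd ℂ) a) / (1 - t * a)) * pinv p b (mobius t z),
    fun z => -((1 - ‖b‖ ^ 2 : ℝ) : ℂ) * b⁻¹ ^ (p + 1) / (1 - (starRingEnd ℂ) b * mobius t z),
    ?_, ?_, ?_, ?_⟩
  · unfold pinv
    fun_prop
  · apply DifferentiableOn.div (by fun_prop) (by fun_prop)
    intro z hz
    have hz' : ‖z‖ < 1 := by simpa [unitDisc] using hz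
    exact aux_ne hb1 (mobius_norm_lt htn hz').le
  · intro z hz
    have hz' : ‖z‖ < 1 := by simpa [unitDisc] using hz
    have hc : ‖-((1 - t * (starRingEnd ℂ) a) / (1 - t * a))‖ = 1 := by
      have : (1 - t * (starRingEnd ℂ) a) = (starRingEnd ℂ) (1 - t * a) := by simp
      rw [norm_neg, norm_div, this, RCLike.norm_conj, div_self (norm_ne_zero_iff.mpr hk)]
    rw [norm_mul, hc, one_mul]
    exact (pinv_bound p hb1 (mobius_norm_lt htn hz')).trans (le_of_lt hb)
  · intro z hz
    have hz' : ‖z‖ < 1 := by simpa [unitDisc] using hz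
    have h1 := pinv_mul p hb0 hb1 (mobius_norm_lt htn hz')
    have h2 := mobius_comp t ht ha hz'
    rw [← hbdef] at h2
    dsimp only
    rw [← h1, h2]
    ring

lemma prod_factor {d : ℕ} (M R h : Fin d → ℂ → ℂ) (u : ℂ → ℂ) (hu : DifferentiableOn ℂ u unitDisc)
    (hh : ∀ l, DifferentiableOn ℂ (h l) unitDisc)
    (hM : ∀ l, ∀ z ∈ unitDisc, M l z * R l z = 1 + u z * h l z) (s : Finset (Fin d)) :
    ∃ H : ℂ → ℂ, DifferentiableOn ℂ H unitDisc ∧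
      ∀ z ∈ unitDisc, (∏ l ∈ s, M l z) * (∏ l ∈ s, R l z) = 1 + u z * H z := by
  induction s using Finset.induction_on with
  | empty => exact ⟨fun _ => 0, by fun_prop, by simp⟩
  | insert a s has ih =>
    obtain ⟨H, hH, hE⟩ := ih
    have := hh a
    refine ⟨fun z => h a z + H z + u z * h a z * H z, by fun_prop, fun z hz => ?_⟩
    rw [Finset.prod_insert has, Finset.prod_insert has, mul_mul_mul_comm, hM a z hz, hE z hz]
    ring

lemma iter_deriv_van {f K : ℂ → ℂ} {γ x : ℂ} {m : ℕ} (hx : x ∈ unitDisc)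
    (hf : DifferentiableOn ℂ f unitDisc)
    (hK : DifferentiableOn ℂ K unitDisc) (hE : ∀ z ∈ unitDisc, f z = γ + (z - x) ^ m * K z)
    (k : ℕ) (hk1 : 1 ≤ k) (hk : k < m) : iteratedDeriv k f x = 0 := by
  have hn : unitDisc ∈ 𝓝 x := Metric.isOpen_ball.mem_nhds hx
  have hKa : AnalyticAt ℂ K x := hK.analyticAt hn
  have hfa : AnalyticAt ℂ f x := hf.analyticAt hn
  have hga : AnalyticAt ℂ (fun z => f z - γ) x := hfa.sub analyticAt_const
  have ho : (m : ℕ∞) ≤ analyticOrderAt (fun z => f z - γ) x := by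
    rw [natCast_le_analyticOrderAt hga]
    refine ⟨K, hKa, ?_⟩
    filter_upwards [hn] with z hz
    rw [hE z hz]; simp
  rw [natCast_le_analyticOrderAt_iff_iteratedDeriv_eq_zero hga] at ho
  have h := ho k hk
  have h2 : f = fun z => γ + (f z - γ) := by ext z; ring
  rw [h2, iteratedDeriv_const_add hk1]
  exact h

/-- Lemma `multPN`: given a finite Blaschke product `B₀`, `γ ∈ 𝔻` and `m ≥ 1`, there are
`ζ* ∈ 𝔻` and `f : 𝔻 → 𝔻` holomorphic with `f = B₀ ⬝ g̃`, `|g̃| ≤ 1`, such that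
`f(ζ*) = γ` and `f⁽ᵏ⁾(ζ*) = 0` for `1 ≤ k ≤ m - 1`. -/
theorem blaschke_multiple_interpolation
    (d : ℕ) (θ₀ : ℝ) (α : Fin d → ℂ) (hα : ∀ l, α l ∈ unitDisc)
    (B₀ : ℂ → ℂ) (hB₀ : ∀ ζ, B₀ ζ = Complex.exp (θ₀ * Complex.I) * ∏ l, mobius (α l) ζ)
    (γ : ℂ) (hγ : γ ∈ unitDisc) (m : ℕ) (hm : 1 ≤ m) :
    ∃ (ζstar : ℂ) (f gt : ℂ → ℂ), ζstar ∈ unitDisc ∧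
      DifferentiableOn ℂ f unitDisc ∧ (∀ w ∈ unitDisc, f w ∈ unitDisc) ∧
      DifferentiableOn ℂ gt unitDisc ∧ (∀ w ∈ unitDisc, ‖gt w‖ ≤ 1) ∧
      (∀ w ∈ unitDisc, f w = B₀ w * gt w) ∧
      f ζstar = γ ∧
      (∀ k, 1 ≤ k → k ≤ m - 1 → iteratedDeriv k f ζstar = 0) := by
  obtain ⟨p, rfl⟩ : ∃ p, m = p + 1 := ⟨m - 1, by omega⟩
  have hα' : ∀ l, ‖α l‖ < 1 := fun l => by simpa [unitDisc] using hα l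
  have hγ' : ‖γ‖ < 1 := by simpa [unitDisc] using hγ
  obtain ⟨ε, hε, hεb⟩ : ∃ ε : ℝ, 0 < ε ∧ ‖γ‖ * (1 + ε) ^ d < 1 := by
    have hc : ContinuousAt (fun ε : ℝ => ‖γ‖ * (1 + ε) ^ d) 0 := by fun_prop
    have h1 : ∀ᶠ ε : ℝ in 𝓝 0, ‖γ‖ * (1 + ε) ^ d < 1 :=
      hc.tendsto.eventually (gt_mem_nhds (by simpa using hγ'))
    have h2 : ∀ᶠ ε : ℝ in 𝓝[>] 0, ‖γ‖ * (1 + ε) ^ d < 1 := nhdsWithin_le_nhds h1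
    have h3 : ∀ᶠ ε : ℝ in 𝓝[>] 0, 0 < ε := eventually_mem_nhdsWithin
    exact (h3.and h2).exists
  have hev := eventually_all.mpr (fun l => factor p (hα' l) hε)
  have hlt : ∀ᶠ t : ℝ in 𝓝[<] 1, t < 1 := eventually_mem_nhdsWithin
  have hgt : ∀ᶠ t : ℝ in 𝓝[<] 1, 0 < t :=
    nhdsWithin_le_nhds (lt_mem_nhds (show (0 : ℝ) < 1 by norm_num))
  obtain ⟨t, hev, hlt, hgt⟩ := (hev.and (hlt.and hgt)).exists
  choose R h hR hh hRb hE using hev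
  have ht : |t| < 1 := by rw [abs_of_pos hgt]; exact hlt
  have htn : ‖(t : ℂ)‖ < 1 := by simpa using ht
  have hmd := mobius_diff htn
  obtain ⟨H, hH, hHE⟩ := prod_factor (fun l => mobius (α l)) R h
    (fun z => mobius t z ^ (p + 1)) (by fun_prop) hh hE Finset.univ
  have hex : Complex.exp (θ₀ * Complex.I) * Complex.exp (-(θ₀ * Complex.I)) = 1 := by
    rw [← Complex.exp_add]; simp
  have hen : ‖Complex.exp (-(θ₀ * Complex.I))‖ = 1 := by
    have : -((θ₀ : ℂ) * Complex.I) = ((-θ₀ : ℝ) : ℂ) * Complex.I := by push_cast; ring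
    rw [this, Complex.norm_exp_ofReal_mul_I]
  set g : ℂ → ℂ := fun z => γ * Complex.exp (-(θ₀ * Complex.I)) * ∏ l, R l z with hg
  have hgd : DifferentiableOn ℂ g unitDisc := by
    apply DifferentiableOn.const_mul
    exact DifferentiableOn.fun_finsetProd (fun l _ => hR l)
  have hBd : DifferentiableOn ℂ B₀ unitDisc := by
    rw [funext hB₀]
    apply DifferentiableOn.const_mul
    exact DifferentiableOn.fun_finsetProd (fun l _ => mobius_diff (hα' l))
  have hgb : ∀ w ∈ unitDisc, ‖g w‖ < 1 := by
    intro w hw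
    refine lt_of_le_of_lt ?_ hεb
    simp only [hg]
    rw [norm_mul, norm_mul, hen, mul_one, norm_prod]
    gcongr
    calc ∏ l, ‖R l w‖ ≤ ∏ l : Fin d, (1 + ε) :=
          Finset.prod_le_prod (fun _ _ => norm_nonneg _) (fun l _ => hRb l w hw)
      _ = (1 + ε) ^ d := by simp
  have hBb : ∀ w ∈ unitDisc, ‖B₀ w‖ ≤ 1 := by
    intro w hw
    have hw' : ‖w‖ < 1 := by simpa [unitDisc] using hw
    rw [hB₀, norm_mul, Complex.norm_exp_ofReal_mul_I, one_mul, norm_prod]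
    exact Finset.prod_le_one (fun _ _ => norm_nonneg _) (fun l _ => (mobius_norm_lt (hα' l) hw').le)
  have htD : (t : ℂ) ∈ unitDisc := by simpa [unitDisc] using ht
  have hfE : ∀ w ∈ unitDisc, B₀ w * g w = γ + mobius t w ^ (p + 1) * (γ * H w) := by
    intro w hw
    have h1 := hHE w hw
    rw [hB₀]
    simp only [hg]
    linear_combination (γ * (∏ l, mobius (α l) w) * ∏ l, R l w) * hex + γ * h1
  have hfd : DifferentiableOn ℂ (fun w => B₀ w * g w) unitDisc := by fun_prop
  refine ⟨t, fun w => B₀ w * g w, g, htD, hfd, ?_, hgd, fun w hw => (hgb w hw).le,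
    fun w _ => rfl, ?_, ?_⟩
  · intro w hw
    have : ‖B₀ w * g w‖ < 1 := by
      rw [norm_mul]
      nlinarith [hgb w hw, hBb w hw, norm_nonneg (g w), norm_nonneg (B₀ w)]
    simpa [unitDisc] using this
  · have := hfE t htD
    simpa [mobius] using this
  · intro k hk1 hk
    have hne : ∀ w ∈ unitDisc, 1 - (starRingEnd ℂ) (t : ℂ) * w ≠ 0 := fun w hw =>
      aux_ne htn (by simpa [unitDisc] using hw : ‖w‖ < 1).le
    refine iter_deriv_van (m := p + 1) (γ := γ) (K := fun w =>
      (-(1 - (starRingEnd ℂ) (t : ℂ) * w)⁻¹) ^ (p + 1) * (γ * H w)) htD hfd ?_ ?_ k hk1 (by omega)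
    · have : DifferentiableOn ℂ (fun w => (1 - (starRingEnd ℂ) (t : ℂ) * w)⁻¹) unitDisc :=
        DifferentiableOn.fun_inv (by fun_prop) hne
      fun_prop
    · intro w hw
      rw [hfE w hw, ← mul_assoc ((w - (t : ℂ)) ^ (p + 1)), ← mul_pow]
      have : mobius t w = (w - t) * -(1 - (starRingEnd ℂ) (t : ℂ) * w)⁻¹ := by
        rw [mobius]; ring
      rw [this]
end
end

section
/- Let a, b ∈ 𝔻 be distinct and let z₁ ∈ 𝔻 with z₁ ≠ a and z₁ ≠ b. Then L_{a0bV}(z₁, 0) > L_{a0b0}(z₁, 0); equivalently, L_{a0bV}(z₁,0) > log|φ_a(z₁)| + log|φ_b(z₁)|. -/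
open Complex Metric Filter Topology

noncomputable section

/-- An analytic disc in the bidisc `𝔻²`, given by its two components. -/
def AnalyticDisc2 (φ₁ φ₂ : ℂ → ℂ) : Prop :=
  DifferentiableOn ℂ φ₁ unitDisc ∧ DifferentiableOn ℂ φ₂ unitDisc ∧
  (∀ w ∈ unitDisc, φ₁ w ∈ unitDisc) ∧ (∀ w ∈ unitDisc, φ₂ w ∈ unitDisc)

/-- The Lempert function with the two simple poles `(a,0)`, `(b,0)` in the bidisc. -/
def La0b0 (a b : ℂ) (z : ℂ × ℂ) : EReal :=
  sInf { t : EReal | ∃ (φ₁ φ₂ : ℂ → ℂ) (ζ₁ ζ₂ : ℂ),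
    AnalyticDisc2 φ₁ φ₂ ∧ ζ₁ ∈ unitDisc ∧ ζ₂ ∈ unitDisc ∧
    φ₁ 0 = z.1 ∧ φ₂ 0 = z.2 ∧
    φ₁ ζ₁ = a ∧ φ₂ ζ₁ = 0 ∧ φ₁ ζ₂ = b ∧ φ₂ ζ₂ = 0 ∧
    t = elog ‖ζ₁‖ + elog ‖ζ₂‖ }

/-- The generalized Lempert function with vertical indicator at `(a,0)` and
simple pole `(b,0)`. -/
def LaVb0 (a b : ℂ) (z : ℂ × ℂ) : EReal :=
  sInf { t : EReal | ∃ (φ₁ φ₂ : ℂ → ℂ) (ζ₁ ζ₂ : ℂ),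
    AnalyticDisc2 φ₁ φ₂ ∧ ζ₁ ∈ unitDisc ∧ ζ₂ ∈ unitDisc ∧
    φ₁ 0 = z.1 ∧ φ₂ 0 = z.2 ∧
    φ₁ ζ₁ = a ∧ φ₂ ζ₁ = 0 ∧ φ₁ ζ₂ = b ∧ φ₂ ζ₂ = 0 ∧
    deriv φ₁ ζ₁ = 0 ∧
    t = elog ‖ζ₁‖ + elog ‖ζ₁‖ + elog ‖ζ₂‖ }

/-- The generalized Lempert function with simple pole `(a,0)` and vertical
indicator at `(b,0)`. -/
def La0bV (a b : ℂ) (z : ℂ × ℂ) : EReal :=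
  sInf { t : EReal | ∃ (φ₁ φ₂ : ℂ → ℂ) (ζ₁ ζ₂ : ℂ),
    AnalyticDisc2 φ₁ φ₂ ∧ ζ₁ ∈ unitDisc ∧ ζ₂ ∈ unitDisc ∧
    φ₁ 0 = z.1 ∧ φ₂ 0 = z.2 ∧
    φ₁ ζ₁ = a ∧ φ₂ ζ₁ = 0 ∧ φ₁ ζ₂ = b ∧ φ₂ ζ₂ = 0 ∧
    deriv φ₁ ζ₂ = 0 ∧
    t = elog ‖ζ₁‖ + elog ‖ζ₂‖ + elog ‖ζ₂‖ }

/-- The generalized Lempert function with vertical indicators at `(a,0)` and `(b,0)`. -/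
def LaVbV (a b : ℂ) (z : ℂ × ℂ) : EReal :=
  sInf { t : EReal | ∃ (φ₁ φ₂ : ℂ → ℂ) (ζ₁ ζ₂ : ℂ),
    AnalyticDisc2 φ₁ φ₂ ∧ ζ₁ ∈ unitDisc ∧ ζ₂ ∈ unitDisc ∧
    φ₁ 0 = z.1 ∧ φ₂ 0 = z.2 ∧
    φ₁ ζ₁ = a ∧ φ₂ ζ₁ = 0 ∧ φ₁ ζ₂ = b ∧ φ₂ ζ₂ = 0 ∧
    deriv φ₁ ζ₁ = 0 ∧ deriv φ₁ ζ₂ = 0 ∧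
    t = elog ‖ζ₁‖ + elog ‖ζ₁‖
        + elog ‖ζ₂‖ + elog ‖ζ₂‖ }

/-- Coman's Lempert function with the three simple poles `(a,0)`, `(b,0)`, `(b,ε)`. -/
def Leps3 (a b ε : ℂ) (z : ℂ × ℂ) : EReal :=
  sInf { t : EReal | ∃ (φ₁ φ₂ : ℂ → ℂ) (ζ₁ ζ₂ ζ₃ : ℂ),
    AnalyticDisc2 φ₁ φ₂ ∧ ζ₁ ∈ unitDisc ∧ ζ₂ ∈ unitDisc ∧ ζ₃ ∈ unitDisc ∧
    φ₁ 0 = z.1 ∧ φ₂ 0 = z.2 ∧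
    φ₁ ζ₁ = a ∧ φ₂ ζ₁ = 0 ∧ φ₁ ζ₂ = b ∧ φ₂ ζ₂ = 0 ∧ φ₁ ζ₃ = b ∧ φ₂ ζ₃ = ε ∧
    t = elog ‖ζ₁‖ + elog ‖ζ₂‖ + elog ‖ζ₃‖ }

/-- Coman's Lempert function with the four simple poles
`(a,0)`, `(b,0)`, `(b,ε)`, `(a,ε)`. -/
def Leps4 (a b ε : ℂ) (z : ℂ × ℂ) : EReal :=
  sInf { t : EReal | ∃ (φ₁ φ₂ : ℂ → ℂ) (ζ₁ ζ₂ ζ₃ ζ₄ : ℂ),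
    AnalyticDisc2 φ₁ φ₂ ∧ ζ₁ ∈ unitDisc ∧ ζ₂ ∈ unitDisc ∧ ζ₃ ∈ unitDisc ∧ ζ₄ ∈ unitDisc ∧
    φ₁ 0 = z.1 ∧ φ₂ 0 = z.2 ∧
    φ₁ ζ₁ = a ∧ φ₂ ζ₁ = 0 ∧ φ₁ ζ₂ = b ∧ φ₂ ζ₂ = 0 ∧
    φ₁ ζ₃ = b ∧ φ₂ ζ₃ = ε ∧ φ₁ ζ₄ = a ∧ φ₂ ζ₄ = ε ∧
    t = elog ‖ζ₁‖ + elog ‖ζ₂‖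
        + elog ‖ζ₃‖ + elog ‖ζ₄‖ }

theorem mb_mem {z : ℂ} : z ∈ unitDisc ↔ ‖z‖ < 1 := by simp [unitDisc]

theorem mb_ident (p q : ℂ) :
    ‖1 - (starRingEnd ℂ) p * q‖ ^ 2 = ‖p - q‖ ^ 2 + (1 - ‖p‖ ^ 2) * (1 - ‖q‖ ^ 2) := by
  simp only [← Complex.normSq_eq_norm_sq, Complex.normSq_apply]
  simp
  ring

theorem mb_den {p q : ℂ} (hp : ‖p‖ < 1) (hq : ‖q‖ < 1) : 1 - (starRingEnd ℂ) p * q ≠ 0 := by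
  intro h
  have h1 := mb_ident p q
  rw [h] at h1
  have : 0 < (1 - ‖p‖ ^ 2) * (1 - ‖q‖ ^ 2) := by
    apply mul_pos <;> nlinarith [norm_nonneg p, norm_nonneg q]
  simp at h1
  nlinarith [sq_nonneg ‖p - q‖]

theorem mb_lt {p q : ℂ} (hp : ‖p‖ < 1) (hq : ‖q‖ < 1) : ‖mobius p q‖ < 1 := by
  have hd := norm_pos_iff.2 (mb_den hp hq)
  rw [mobius, norm_div, div_lt_one hd]
  have : 0 < (1 - ‖p‖ ^ 2) * (1 - ‖q‖ ^ 2) := by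
    apply mul_pos <;> nlinarith [norm_nonneg p, norm_nonneg q]
  apply lt_of_pow_lt_pow_left₀ 2 hd.le
  rw [mb_ident]; linarith

theorem mb_invol {p q : ℂ} (hp : ‖p‖ < 1) (hq : ‖q‖ < 1) : mobius p (mobius p q) = q := by
  have h1 := mb_den hp hq
  have h2 := mb_den hp hp
  have h3 := mb_den hp (mb_lt hp hq)
  unfold mobius at *
  rw [div_eq_iff h3]
  have h4 := div_mul_cancel₀ (p - q) h1
  linear_combination -h4

theorem mb_symm (p q : ℂ) : ‖mobius p q‖ = ‖mobius q p‖ := by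
  unfold mobius
  rw [norm_div, norm_div, norm_sub_rev p q]
  congr 1
  rw [← Complex.norm_conj]
  simp [mul_comm]

theorem mb_diff {p q : ℂ} (hp : ‖p‖ < 1) (hq : ‖q‖ < 1) : DifferentiableAt ℂ (mobius p) q := by
  unfold mobius
  have := mb_den hp hq
  fun_prop (disch := assumption)

theorem mb_zero (p : ℂ) : mobius p 0 = p := by simp [mobius]
theorem mb_self (p : ℂ) : mobius p p = 0 := by simp [mobius]

theorem le_of_sq_aux {x y : ℝ} (h : x ^ 2 ≤ y ^ 2) (hy : 0 ≤ y) : x ≤ y :=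
  (le_abs_self x).trans (abs_le_of_sq_le_sq h hy)

theorem mb_upper {p q : ℂ} (hp : ‖p‖ < 1) (hq : ‖q‖ < 1) :
    ‖mobius p q‖ ≤ (‖p‖ + ‖q‖) / (1 + ‖p‖ * ‖q‖) := by
  have hd := norm_pos_iff.2 (mb_den hp hq)
  have h0 := norm_nonneg p
  have h1 := norm_nonneg q
  have h2 := norm_sub_le p q
  have h3 := mb_ident p q
  rw [mobius, norm_div, div_le_div_iff₀ hd (by positivity)]
  refine le_of_sq_aux ?_ (by positivity)
  have : 0 < (1 - ‖p‖ ^ 2) * (1 - ‖q‖ ^ 2) := by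
    apply mul_pos <;> nlinarith
  have h4 : ‖p - q‖ ^ 2 ≤ (‖p‖ + ‖q‖) ^ 2 := by gcongr
  rw [mul_pow, mul_pow, h3]
  nlinarith [mul_nonneg this.le (sub_nonneg.2 h4)]

theorem mb_lower {p q : ℂ} (hp : ‖p‖ < 1) (hq : ‖q‖ < 1) :
    (‖p‖ - ‖q‖) / (1 - ‖p‖ * ‖q‖) ≤ ‖mobius p q‖ := by
  have hd := norm_pos_iff.2 (mb_den hp hq)
  have h0 := norm_nonneg p
  have h1 := norm_nonneg q
  have h3 := mb_ident p q
  have hst : 0 < 1 - ‖p‖ * ‖q‖ := by nlinarith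
  rw [mobius, norm_div, div_le_div_iff₀ hst hd]
  refine le_of_sq_aux ?_ (by positivity)
  have : 0 < (1 - ‖p‖ ^ 2) * (1 - ‖q‖ ^ 2) := by
    apply mul_pos <;> nlinarith
  have h4 : (‖p‖ - ‖q‖) ^ 2 ≤ ‖p - q‖ ^ 2 := by
    apply sq_le_sq'
    · have := norm_sub_norm_le q p
      rw [norm_sub_rev] at this
      linarith
    · exact norm_sub_norm_le p q
  rw [mul_pow, mul_pow, h3]
  nlinarith [mul_nonneg this.le (sub_nonneg.2 h4)]

theorem mb_pick_aux {f : ℂ → ℂ} (hf : DifferentiableOn ℂ f (ball 0 1))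
    (hm : ∀ w, ‖w‖ < 1 → ‖f w‖ < 1) {w : ℂ} (hw : ‖w‖ < 1) :
    DifferentiableOn ℂ (fun u => mobius (f w) (f (mobius w u))) (ball 0 1) ∧
    Set.MapsTo (fun u => mobius (f w) (f (mobius w u))) (ball 0 1)
      (closedBall (mobius (f w) (f (mobius w 0))) 1) := by
  constructor
  · intro u hu
    rw [mem_ball_zero_iff] at hu
    have h1 := mb_lt hw hu
    have h2 := mb_diff (hm w hw) (hm _ h1)
    have h3 : DifferentiableAt ℂ f (mobius w u) :=
      hf.differentiableAt (isOpen_ball.mem_nhds (by simpa using h1))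
    have h4 := mb_diff hw hu
    exact ((h2.comp (mobius w u) h3).comp u h4).differentiableWithinAt
  · intro u hu
    rw [mem_ball_zero_iff] at hu
    rw [mb_zero, mb_self, mem_closedBall_zero_iff]
    exact (mb_lt (hm w hw) (hm _ (mb_lt hw hu))).le

theorem mb_pick {f : ℂ → ℂ} (hf : DifferentiableOn ℂ f (ball 0 1))
    (hm : ∀ w, ‖w‖ < 1 → ‖f w‖ < 1) {w z : ℂ} (hw : ‖w‖ < 1) (hz : ‖z‖ < 1) :
    ‖mobius (f w) (f z)‖ ≤ ‖mobius w z‖ := by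
  obtain ⟨h1, h2⟩ := mb_pick_aux hf hm hw
  have := dist_le_dist_of_mapsTo_ball h1 h2 (z := mobius w z) (by simpa using mb_lt hw hz)
  simpa [mb_zero, mb_self, mb_invol hw hz] using this

theorem mb_pick2 {f : ℂ → ℂ} (hf : DifferentiableOn ℂ f (ball 0 1))
    (hm : ∀ w, ‖w‖ < 1 → ‖f w‖ < 1) {w z : ℂ} (hw : ‖w‖ < 1) (hz : ‖z‖ < 1)
    (hd : deriv f w = 0) :
    ‖mobius (f w) (f z)‖ ≤ ‖mobius w z‖ ^ 2 := by
  obtain ⟨h1, h2⟩ := mb_pick_aux hf hm hw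
  have h3 : DifferentiableAt ℂ f w :=
      hf.differentiableAt (isOpen_ball.mem_nhds (by simpa using hw))
  have h4 : HasDerivAt f 0 (mobius w 0) := by rw [mb_zero, ← hd]; exact h3.hasDerivAt
  have h5 : HasDerivAt (fun u => mobius (f w) (f (mobius w u))) 0 0 := by
    have e1 := (mb_diff hw (q := 0) (by simp)).hasDerivAt
    have e2 := (mb_diff (hm w hw) (hm w hw)).hasDerivAt
    have e3 := h4.comp (0 : ℂ) e1
    have e4 : HasDerivAt (mobius (f w)) (deriv (mobius (f w)) (f w)) ((f ∘ mobius w) 0) := by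
      simpa [mb_zero] using e2
    have e5 := e4.comp (0 : ℂ) e3
    rw [zero_mul, mul_zero] at e5
    exact e5
  have h6 := h5.isLittleO
  have := dist_le_mul_div_pow_of_mapsTo_ball_of_isLittleO (n := 1) h1 h2
    (by simpa using h6.norm_right) (z := mobius w z) (by simpa using mb_lt hw hz)
  simpa [mb_zero, mb_self, mb_invol hw hz] using this

/-- A consequence of Schwarz-Pick for maps into the closed disc. -/
theorem mb_closed {h : ℂ → ℂ} (hf : DifferentiableOn ℂ h (ball 0 1))
    (hm : ∀ w, ‖w‖ < 1 → ‖h w‖ ≤ 1) {w z : ℂ} (hw : ‖w‖ < 1) (hz : ‖z‖ < 1) :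
    (‖h w‖ - ‖h z‖) * (1 + ‖w‖ * ‖z‖) ≤ (‖w‖ + ‖z‖) * (1 - ‖h w‖ * ‖h z‖) := by
  have key : ∀ r ∈ Set.Ioo (0 : ℝ) 1,
      (r * ‖h w‖ - r * ‖h z‖) * (1 + ‖w‖ * ‖z‖)
        ≤ (‖w‖ + ‖z‖) * (1 - (r * ‖h w‖) * (r * ‖h z‖)) := by
    intro r hr
    have hn : ∀ u, ‖(r : ℂ) * h u‖ = r * ‖h u‖ := fun u => by
      rw [norm_mul, Complex.norm_real, Real.norm_of_nonneg hr.1.le]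
    have hm' : ∀ u, ‖u‖ < 1 → ‖(r : ℂ) * h u‖ < 1 := fun u hu => by
      rw [hn]
      nlinarith [hm u hu, hr.1, hr.2, norm_nonneg (h u)]
    have h1 := mb_pick (f := fun u => (r : ℂ) * h u) (hf.const_mul _) hm' hw hz
    have h2 := mb_lower (hm' w hw) (hm' z hz)
    have h3 := mb_upper hw hz
    have h4 := (h2.trans h1).trans h3
    have h5 := hm' w hw
    have h6 := hm' z hz
    rw [hn] at h5 h6
    rw [hn, hn, div_le_div_iff₀ _ (by positivity)] at h4
    · exact h4
    · have := norm_nonneg (h w)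
      have := norm_nonneg (h z)
      have := hr.1
      nlinarith [mul_nonneg hr.1.le (norm_nonneg (h w)), mul_nonneg hr.1.le (norm_nonneg (h z))]
  have hev : ∀ᶠ r in 𝓝[<] (1 : ℝ), (r * ‖h w‖ - r * ‖h z‖) * (1 + ‖w‖ * ‖z‖)
        ≤ (‖w‖ + ‖z‖) * (1 - (r * ‖h w‖) * (r * ‖h z‖)) := by
    filter_upwards [Ioo_mem_nhdsLT (zero_lt_one (α := ℝ))] with r hr using key r hr
  have c1 : Tendsto (fun r : ℝ => (r * ‖h w‖ - r * ‖h z‖) * (1 + ‖w‖ * ‖z‖)) (𝓝[<] 1)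
      (𝓝 ((1 * ‖h w‖ - 1 * ‖h z‖) * (1 + ‖w‖ * ‖z‖))) :=
    ((by fun_prop : Continuous (fun r : ℝ => (r * ‖h w‖ - r * ‖h z‖) * (1 + ‖w‖ * ‖z‖))).tendsto
      1).mono_left nhdsWithin_le_nhds
  have c2 : Tendsto (fun r : ℝ => (‖w‖ + ‖z‖) * (1 - (r * ‖h w‖) * (r * ‖h z‖))) (𝓝[<] 1)
      (𝓝 ((‖w‖ + ‖z‖) * (1 - (1 * ‖h w‖) * (1 * ‖h z‖)))) :=
    ((by fun_prop : Continuous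
      (fun r : ℝ => (‖w‖ + ‖z‖) * (1 - (r * ‖h w‖) * (r * ‖h z‖)))).tendsto
      1).mono_left nhdsWithin_le_nhds
  simpa using le_of_tendsto_of_tendsto c1 c2 hev

/-- The constraint coming from dividing out the zero at the origin. -/
theorem mb_constraint {f : ℂ → ℂ} (hf : DifferentiableOn ℂ f (ball 0 1))
    (hm : ∀ w, ‖w‖ < 1 → ‖f w‖ < 1) {w z : ℂ} (hw : ‖w‖ < 1) (hz : ‖z‖ < 1)
    (hw0 : w ≠ 0) (hz0 : z ≠ 0) :
    (‖mobius (f 0) (f w)‖ * ‖z‖ - ‖mobius (f 0) (f z)‖ * ‖w‖) * (1 + ‖w‖ * ‖z‖)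
      ≤ (‖w‖ + ‖z‖) * (‖w‖ * ‖z‖ - ‖mobius (f 0) (f w)‖ * ‖mobius (f 0) (f z)‖) := by
  set g : ℂ → ℂ := fun u => mobius (f 0) (f u) with hg
  have h0 : ‖f 0‖ < 1 := hm 0 (by simp)
  have g0 : g 0 = 0 := mb_self _
  have gd : DifferentiableOn ℂ g (ball 0 1) := by
    intro u hu
    have hu' : ‖u‖ < 1 := by simpa using hu
    exact ((mb_diff h0 (hm _ hu')).comp u
      (hf.differentiableAt (isOpen_ball.mem_nhds hu))).differentiableWithinAt
  have gm : Set.MapsTo g (ball 0 1) (closedBall (g 0) 1) := by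
    intro u hu
    have hu' : ‖u‖ < 1 := by simpa using hu
    rw [g0, mem_closedBall_zero_iff]
    exact (mb_lt h0 (hm _ hu')).le
  have hd : DifferentiableOn ℂ (dslope g 0) (ball 0 1) :=
    (differentiableOn_dslope (isOpen_ball.mem_nhds (by simp))).mpr gd
  have hb : ∀ u, ‖u‖ < 1 → ‖dslope g 0 u‖ ≤ 1 := fun u hu => by
    simpa using norm_dslope_le_div_of_mapsTo_ball gd gm (z := u) (by simpa using hu)
  have hv : ∀ u, u ≠ 0 → ‖dslope g 0 u‖ = ‖g u‖ / ‖u‖ := fun u hu => by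
    rw [dslope_of_ne _ hu, slope_def_field, g0]; simp
  have := mb_closed hd hb hw hz
  rw [hv w hw0, hv z hz0] at this
  have pw := norm_pos_iff.2 hw0
  have pz := norm_pos_iff.2 hz0
  have e1 : (‖g w‖ * ‖z‖ - ‖g z‖ * ‖w‖) * (1 + ‖w‖ * ‖z‖)
      = (‖w‖ * ‖z‖) * ((‖g w‖ / ‖w‖ - ‖g z‖ / ‖z‖) * (1 + ‖w‖ * ‖z‖)) := by
    field_simp
  have e2 : (‖w‖ + ‖z‖) * (‖w‖ * ‖z‖ - ‖g w‖ * ‖g z‖)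
      = (‖w‖ * ‖z‖) * ((‖w‖ + ‖z‖) * (1 - ‖g w‖ / ‖w‖ * (‖g z‖ / ‖z‖))) := by
    field_simp
  rw [e1, e2]
  exact mul_le_mul_of_nonneg_left this (by positivity)

/-- Uniform gap by compactness. -/
theorem mb_gap {A B : ℝ} (hA : 0 < A) (hA1 : A < 1) (hB : 0 < B) (hB1 : B < 1) :
    ∃ m, A * B < m ∧ ∀ x y : ℝ, A ≤ x → x ≤ 1 → 0 ≤ y → B ≤ y ^ 2 → y ≤ 1 →
      (A * y - B * x) * (1 + x * y) ≤ (x + y) * (x * y - A * B) → m ≤ x * y ^ 2 := by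
  set K : Set (ℝ × ℝ) := (Set.Icc A 1 ×ˢ Set.Icc 0 1) ∩ ({p | B ≤ p.2 ^ 2} ∩
    {p | (A * p.2 - B * p.1) * (1 + p.1 * p.2) ≤ (p.1 + p.2) * (p.1 * p.2 - A * B)}) with hK
  have hKc : IsCompact K := by
    apply (isCompact_Icc.prod isCompact_Icc).inter_right
    exact (isClosed_le (by fun_prop) (by fun_prop)).inter
      (isClosed_le (by fun_prop) (by fun_prop))
  rcases K.eq_empty_or_nonempty with he | hne
  · refine ⟨A * B + 1, by linarith, fun x y h1 h2 h3 h4 h5 h6 => ?_⟩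
    have : (x, y) ∈ K := ⟨⟨⟨h1, h2⟩, ⟨h3, h5⟩⟩, h4, h6⟩
    rw [he] at this
    exact this.elim
  · obtain ⟨⟨x, y⟩, ⟨⟨⟨h1, h2⟩, ⟨h3, h5⟩⟩, h4, h6⟩, hmin⟩ :=
      hKc.exists_isMinOn hne (f := fun p : ℝ × ℝ => p.1 * p.2 ^ 2) (by fun_prop)
    refine ⟨x * y ^ 2, ?_, fun x' y' h1 h2 h3 h4 h5 h6 =>
      hmin (a := (x', y')) ⟨⟨⟨h1, h2⟩, ⟨h3, h5⟩⟩, h4, h6⟩⟩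
    simp only [Set.mem_setOf_eq] at h1 h2 h3 h4 h5 h6
    by_contra hcon
    push Not at hcon
    have hx : x = A := by nlinarith
    have hy : B = y ^ 2 := by subst hx; nlinarith
    have hy0 : 0 < y := by
      rcases h3.eq_or_lt with h | h
      · subst h; simp at hy; linarith
      · exact h
    have hy1 : y < 1 := by nlinarith
    subst hx hy
    have : x * y * (1 - y) * ((1 - x) * (1 - y)) ≤ 0 := by nlinarith
    have : 0 < x * y * (1 - y) * ((1 - x) * (1 - y)) := by
      have := sub_pos.2 hA1
      have := sub_pos.2 hy1
      positivity
    linarith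

theorem mb_pos {p q : ℂ} (hp : ‖p‖ < 1) (hq : ‖q‖ < 1) (h : q ≠ p) : 0 < ‖mobius p q‖ := by
  rw [norm_pos_iff, mobius]
  exact div_ne_zero (sub_ne_zero.2 h.symm) (mb_den hp hq)

theorem mb_La0b0_le {a b z₁ : ℂ} (ha : ‖a‖ < 1) (hb : ‖b‖ < 1)
    (hz : ‖z₁‖ < 1) (hza : z₁ ≠ a) (hzb : z₁ ≠ b) :
    La0b0 a b (z₁, 0) ≤ ((Real.log ‖mobius a z₁‖ + Real.log ‖mobius b z₁‖ : ℝ) : EReal) := by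
  apply sInf_le
  refine ⟨mobius z₁, fun _ => 0, mobius z₁ a, mobius z₁ b, ⟨?_, by fun_prop, ?_, ?_⟩,
    mb_mem.2 (mb_lt hz ha), mb_mem.2 (mb_lt hz hb), mb_zero _, rfl, mb_invol hz ha, rfl,
    mb_invol hz hb, rfl, ?_⟩
  · intro u hu
    exact (mb_diff hz (mb_mem.1 hu)).differentiableWithinAt
  · intro u hu
    exact mb_mem.2 (mb_lt hz (mb_mem.1 hu))
  · intro u hu
    exact mb_mem.2 (by simp)
  · rw [mb_symm z₁ a, mb_symm z₁ b, elog, elog, if_neg (mb_pos ha hz hza).ne',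
      if_neg (mb_pos hb hz hzb).ne', EReal.coe_add]

/-- Proposition `cexnewLemp`: `L_{a0bV}(z₁,0) > L_{a0b0}(z₁,0)
= log|φ_a(z₁)| + log|φ_b(z₁)|`. -/
theorem La0bV_gt_La0b0
    (a b z₁ : ℂ) (ha : a ∈ unitDisc) (hb : b ∈ unitDisc) (hab : a ≠ b)
    (hz : z₁ ∈ unitDisc) (hza : z₁ ≠ a) (hzb : z₁ ≠ b) :
    La0b0 a b (z₁, 0) < La0bV a b (z₁, 0) ∧
    ((Real.log ‖mobius a z₁‖ + Real.log ‖mobius b z₁‖ : ℝ)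
        : EReal)
      < La0bV a b (z₁, 0) := by
  have ha' := mb_mem.1 ha
  have hb' := mb_mem.1 hb
  have hz' := mb_mem.1 hz
  suffices h : ((Real.log ‖mobius a z₁‖ + Real.log ‖mobius b z₁‖ : ℝ) : EReal)
      < La0bV a b (z₁, 0) from ⟨(mb_La0b0_le ha' hb' hz' hza hzb).trans_lt h, h⟩
  have pA := mb_pos ha' hz' hza
  have pB := mb_pos hb' hz' hzb
  obtain ⟨m, hm, hgap⟩ := mb_gap pA (mb_lt ha' hz') pB (mb_lt hb' hz')
  have hm0 : 0 < m := (mul_pos pA pB).trans hm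
  have hlt : ((Real.log ‖mobius a z₁‖ + Real.log ‖mobius b z₁‖ : ℝ) : EReal)
      < ((Real.log m : ℝ) : EReal) := by
    rw [EReal.coe_lt_coe_iff, ← Real.log_mul pA.ne' pB.ne']
    exact Real.log_lt_log (mul_pos pA pB) hm
  refine hlt.trans_le (le_sInf ?_)
  rintro t ⟨f, f₂, ζ₁, ζ₂, ⟨hf, -, hmf, -⟩, h1, h2, hf0, -, hfa, -, hfb, -, hder, rfl⟩
  have h1' := mb_mem.1 h1
  have h2' := mb_mem.1 h2
  have hmf' : ∀ w, ‖w‖ < 1 → ‖f w‖ < 1 := fun w hw => mb_mem.1 (hmf w (mb_mem.2 hw))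
  simp only at hf0
  have hz1 : ζ₁ ≠ 0 := by rintro rfl; exact hza (hf0.symm.trans hfa)
  have hz2 : ζ₂ ≠ 0 := by rintro rfl; exact hzb (hf0.symm.trans hfb)
  have p1 := norm_pos_iff.2 hz1
  have p2 := norm_pos_iff.2 hz2
  have e1 := mb_pick hf hmf' h1' (z := 0) (by simp)
  rw [hfa, hf0, mb_zero] at e1
  have e2 := mb_pick2 hf hmf' h2' (z := 0) (by simp) hder
  rw [hfb, hf0, mb_zero] at e2
  have e3 := mb_constraint hf hmf' h1' h2' hz1 hz2
  rw [hfa, hfb, hf0, mb_symm z₁ a, mb_symm z₁ b] at e3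
  have e4 := hgap _ _ e1 h1'.le p2.le e2 h2'.le e3
  rw [elog, elog, if_neg p1.ne', if_neg p2.ne', ← EReal.coe_add, ← EReal.coe_add,
    EReal.coe_le_coe_iff, ← Real.log_mul p1.ne' p2.ne',
    ← Real.log_mul (mul_pos p1 p2).ne' p2.ne']
  apply Real.log_le_log hm0
  rw [mul_assoc, ← sq]
  exact e4
end
end
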